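/- Assume the family (G,B) satisfies positivity, that G_k ⊥⊥ B_{k−1} | G_{k−1} ∪ {A_{k−1}} for every k = 1,…,p, and that π̃_{a_j} := E[1_{{A_j = a_j}} | σ(Ḡ_j ∪ Ā_{j−1})] ≥ c > 0 a.s. for every j, where Ḡ_j := G_0 ∪ … ∪ G_j. Set λ̃_{ā_{k−1}} := ∏_{j=0}^{k−1} π̃_{a_j} (with λ̃_{ā_{−1}} := 1). Then for every k = 0,…,p, E[ I_{ā_{k−1}}(Ā_{k−1}) / λ_{ā_{k−1}}((G,B)̄_{k−1}) | σ(Ḡ_{k−1} ∪ Ā_{k−1}) ] = I_{ā_{k−1}}(Ā_{k−1}) / λ̃_{ā_{k−1}} almost surely. (Telescoping inverse-weight identity in the proof of Lemma 4.2: on the event Ā_{k−1} = ā_{k−1}, the conditional expectation of the inverse cumulative weight based on (G,B) given the G-history equals the inverse cumulative weight based on the G-history.) -/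

import Mathlib

open MeasureTheory ProbabilityTheory

noncomputable section

/-- The σ-algebra generated by a set of real-valued random variables. -/
def genSig {Ω : Type*} (S : Set (Ω → ℝ)) : MeasurableSpace Ω :=
  ⨆ f ∈ S, MeasurableSpace.comap f (inferInstance : MeasurableSpace ℝ)

/-- Indicator `1_{A = a}` of the event that the random variable `A` takes the value `a`. -/
def ind {Ω : Type*} (A : Ω → ℝ) (a : ℝ) : Ω → ℝ := fun ω => if A ω = a then 1 else 0

/-- `I_{ā_{k-1}}(Ā_{k-1}) = ∏_{j<k} 1_{A_j = a_j}` (equal to `1` when `k = 0`). -/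
def indUpto {Ω : Type*} (A : ℕ → Ω → ℝ) (a : ℕ → ℝ) (k : ℕ) : Ω → ℝ :=
  fun ω => ∏ j ∈ Finset.range k, ind (A j) (a j) ω

variable {Ω : Type*} [MeasurableSpace Ω]

/-- Propensity `π_{a_k}(Z_k) = E[1_{A_k = a_k} ∣ σ(Z_k)]`. -/
def propen (μ : Measure Ω) (A : ℕ → Ω → ℝ) (a : ℕ → ℝ) (Z : ℕ → Set (Ω → ℝ)) (k : ℕ) : Ω → ℝ :=
  μ[ind (A k) (a k) | genSig (Z k)]

/-- Cumulative weight `λ_{ā_{k-1}}(Z̄_{k-1}) = ∏_{j<k} π_{a_j}(Z_j)` (equal to `1` when `k = 0`). -/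
def cumWeight (μ : Measure Ω) (A : ℕ → Ω → ℝ) (a : ℕ → ℝ) (Z : ℕ → Set (Ω → ℝ)) (k : ℕ) :
    Ω → ℝ :=
  fun ω => ∏ j ∈ Finset.range k, propen μ A a Z j ω

/-- The adjustment family `Z` satisfies positivity: the propensities are uniformly bounded away
from `0` almost surely, for every time `k = 0, …, p`. -/
def Positivity (μ : Measure Ω) (A : ℕ → Ω → ℝ) (a : ℕ → ℝ) (Z : ℕ → Set (Ω → ℝ)) (p : ℕ) :
    Prop :=
  ∃ c : ℝ, 0 < c ∧ ∀ k ≤ p, ∀ᵐ ω ∂μ, c ≤ propen μ A a Z k ω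

/-- Auxiliary downward recursion: `bAux μ A a Y Z p n` is the iterated regression
`b_{a_{p-n}}(Z)`. -/
def bAux (μ : Measure Ω) (A : ℕ → Ω → ℝ) (a : ℕ → ℝ) (Y : Ω → ℝ) (Z : ℕ → Set (Ω → ℝ))
    (p : ℕ) : ℕ → Ω → ℝ
  | 0 => fun ω =>
      (μ[fun ω' => Y ω' * ind (A p) (a p) ω' | genSig (Z p)]) ω / propen μ A a Z p ω
  | n + 1 => fun ω =>
      (μ[fun ω' => bAux μ A a Y Z p n ω' * ind (A (p - (n + 1))) (a (p - (n + 1))) ω' |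
          genSig (Z (p - (n + 1)))]) ω / propen μ A a Z (p - (n + 1)) ω

/-- Iterated regression `b_{a_k}(Z)`, for `k = 0, …, p`. -/
def breg (μ : Measure Ω) (A : ℕ → Ω → ℝ) (a : ℕ → ℝ) (Y : Ω → ℝ) (Z : ℕ → Set (Ω → ℝ))
    (p k : ℕ) : Ω → ℝ :=
  bAux μ A a Y Z p (p - k)

/-- `b_{a_{k-1}}(Z)` with the convention `b_{a_{-1}}(Z) = E[b_{a_0}(Z)]` (a constant). -/
def bregPrev (μ : Measure Ω) (A : ℕ → Ω → ℝ) (a : ℕ → ℝ) (Y : Ω → ℝ) (Z : ℕ → Set (Ω → ℝ))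
    (p k : ℕ) : Ω → ℝ :=
  if k = 0 then fun _ => ∫ ω, breg μ A a Y Z p 0 ω ∂μ else breg μ A a Y Z p (k - 1)

/-- The influence function `ψ_a(Z)`. -/
def psi (μ : Measure Ω) (A : ℕ → Ω → ℝ) (a : ℕ → ℝ) (Y : Ω → ℝ) (Z : ℕ → Set (Ω → ℝ))
    (p : ℕ) : Ω → ℝ := fun ω =>
  indUpto A a (p + 1) ω * (Y ω - breg μ A a Y Z p p ω) / cumWeight μ A a Z (p + 1) ω +
    ∑ k ∈ Finset.range (p + 1),
      indUpto A a k ω * (breg μ A a Y Z p k ω - bregPrev μ A a Y Z p k ω) /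
        cumWeight μ A a Z k ω

end

/-- A conditional expectation given a join of two σ-algebras is characterised by its integrals over
intersections of one event from each. -/
theorem condExp_sup_ae_eq_of_forall_setIntegral_inter {Ω : Type*} {m₁ m₂ mΩ : MeasurableSpace Ω}
    {P : Measure Ω} [IsFiniteMeasure P] (hm₁ : m₁ ≤ mΩ) (hm₂ : m₂ ≤ mΩ) {f g : Ω → ℝ}
    (hf : Integrable f P) (hg : Integrable g P) (hgm : AEStronglyMeasurable[m₁ ⊔ m₂] g P)
    (h : ∀ s t, MeasurableSet[m₁] s → MeasurableSet[m₂] t →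
      ∫ ω in s ∩ t, g ω ∂P = ∫ ω in s ∩ t, f ω ∂P) :
    P[f | m₁ ⊔ m₂] =ᵐ[P] g := by
  have hm : m₁ ⊔ m₂ ≤ mΩ := sup_le hm₁ hm₂
  have huniv : ∫ ω, g ω ∂P = ∫ ω, f ω ∂P := by
    simpa using h Set.univ Set.univ MeasurableSet.univ MeasurableSet.univ
  refine (ae_eq_condExp_of_forall_setIntegral_eq hm hf (fun _ _ _ => hg.integrableOn)
    (fun u hu _ => ?_) hgm).symm
  refine @MeasurableSpace.induction_on_inter Ω (m₁ ⊔ m₂)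
    (fun u _ => ∫ ω in u, g ω ∂P = ∫ ω in u, f ω ∂P)
    {u | ∃ s t, MeasurableSet[m₁] s ∧ MeasurableSet[m₂] t ∧ u = s ∩ t} ?_ ?_ ?_ ?_ ?_ ?_ u hu
  · refine le_antisymm (sup_le (fun s hs => ?_) (fun t ht => ?_)) ?_
    · exact MeasurableSpace.measurableSet_generateFrom ⟨s, Set.univ, hs, .univ, by simp⟩
    · exact MeasurableSpace.measurableSet_generateFrom ⟨Set.univ, t, .univ, ht, by simp⟩
    · refine MeasurableSpace.generateFrom_le ?_
      rintro _ ⟨s, t, hs, ht, rfl⟩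
      exact MeasurableSet.inter ((le_sup_left : m₁ ≤ m₁ ⊔ m₂) s hs)
        ((le_sup_right : m₂ ≤ m₁ ⊔ m₂) t ht)
  · rintro _ ⟨s, t, hs, ht, rfl⟩ _ ⟨s', t', hs', ht', rfl⟩ -
    exact ⟨s ∩ s', t ∩ t', hs.inter hs', ht.inter ht', Set.inter_inter_inter_comm _ _ _ _⟩
  · simp
  · rintro _ ⟨s, t, hs, ht, rfl⟩
    exact h s t hs ht
  · intro u hu ih
    have h₁ := integral_add_compl (hm u hu) hg
    have h₂ := integral_add_compl (hm u hu) hf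
    linarith
  · intro u hd hu ih
    rw [integral_iUnion (fun i => hm _ (hu i)) hd hg.integrableOn,
      integral_iUnion (fun i => hm _ (hu i)) hd hf.integrableOn]
    exact tsum_congr ih

/-- Against an `m`-measurable factor, a function may be replaced by its conditional expectation. -/
theorem setIntegral_condExp_mul {Ω : Type*} {m mΩ : MeasurableSpace Ω} {P : Measure Ω}
    [IsFiniteMeasure P] (hm : m ≤ mΩ) {f g : Ω → ℝ} {s : Set Ω} (hs : MeasurableSet[m] s)
    (hf : Integrable f P) (hg : AEStronglyMeasurable[m] g P) (hfg : Integrable (f * g) P) :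
    ∫ ω in s, (P[f | m] * g) ω ∂P = ∫ ω in s, (f * g) ω ∂P := by
  rw [← setIntegral_condExp hm hfg hs]
  refine integral_congr_ae (ae_restrict_of_ae ?_)
  exact (condExp_mul_of_aestronglyMeasurable_right hg hfg hf).symm

theorem ae_norm_condExp_indicator_one_le {Ω : Type*} {m mΩ : MeasurableSpace Ω} {P : Measure Ω}
    [IsFiniteMeasure P] (s : Set Ω) :
    ∀ᵐ ω ∂P, ‖P[s.indicator (fun _ => (1 : ℝ)) | m] ω‖ ≤ 1 := by
  refine ae_bdd_abs_condExp_of_ae_bdd_abs (ae_of_all _ fun ω => ?_)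
  by_cases h : ω ∈ s <;> simp [h]

theorem setIntegral_indicator_one_mul {Ω : Type*} {mΩ : MeasurableSpace Ω} {P : Measure Ω}
    {s : Set Ω} (hs : MeasurableSet s) (t : Set Ω) (f : Ω → ℝ) :
    ∫ ω in t, (s.indicator (fun _ => (1 : ℝ)) * f) ω ∂P = ∫ ω in s ∩ t, f ω ∂P := by
  have : s.indicator (fun _ => (1 : ℝ)) * f = s.indicator f := by
    ext ω
    by_cases h : ω ∈ s <;> simp [h]
  rw [this, setIntegral_indicator hs, Set.inter_comm]

/-- If `g` and `b` are conditionally independent given `m'`, then enlarging the conditioning from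
`m'` to `b ⊔ m'` does not change the conditional probability of an event of `g`. -/
theorem ProbabilityTheory.CondIndep.condExp_indicator_sup_ae_eq {Ω : Type*}
    {m' g b mΩ : MeasurableSpace Ω} [StandardBorelSpace Ω] {P : Measure Ω} [IsFiniteMeasure P] {hm' : m' ≤ mΩ} (hg : g ≤ mΩ)
    (hb : b ≤ mΩ) (h : CondIndep m' g b hm' P) {s : Set Ω} (hs : MeasurableSet[g] s) :
    P[s.indicator (fun _ => (1 : ℝ)) | b ⊔ m'] =ᵐ[P] P[s.indicator (fun _ => (1 : ℝ)) | m'] := by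
  have hint : ∀ {u : Set Ω}, MeasurableSet u → Integrable (u.indicator fun _ => (1 : ℝ)) P :=
    fun hu => (integrable_const 1).indicator hu
  refine condExp_sup_ae_eq_of_forall_setIntegral_inter hb hm' (hint (hg s hs)) integrable_condExp
    (stronglyMeasurable_condExp.mono (le_sup_right : m' ≤ b ⊔ m')).aestronglyMeasurable
    fun u t hu ht => ?_
  rw [← setIntegral_indicator_one_mul (hb u hu), ← setIntegral_indicator_one_mul (hb u hu),
    ← setIntegral_condExp_mul hm' ht (hint (hb u hu))
      stronglyMeasurable_condExp.aestronglyMeasurable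
      (integrable_condExp.bdd_mul (c := 1) (hint (hb u hu)).aestronglyMeasurable
        (ae_of_all _ fun ω => by by_cases h : ω ∈ u <;> simp [h]))]
  have hus : u.indicator (fun _ => (1 : ℝ)) * s.indicator (fun _ => (1 : ℝ))
      = (s ∩ u).indicator fun _ => (1 : ℝ) := by
    ext ω
    by_cases h₁ : ω ∈ s <;> by_cases h₂ : ω ∈ u <;> simp [h₁, h₂]
  rw [hus, ← setIntegral_condExp hm' (hint ((hg s hs).inter (hb u hu))) ht]
  refine integral_congr_ae (ae_restrict_of_ae ?_)
  filter_upwards [(condIndep_iff m' g b hm' hg hb P).1 h s u hs hu] with ω hω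
  rw [hω, Pi.mul_apply, Pi.mul_apply, mul_comm]

/-- Let `g` and `b` be conditionally independent given `m'`, let `m' ≤ m ≤ b ⊔ m'`, and let `W` be
`b ⊔ m'`-measurable. Then `g` carries no further information on `W` beyond `m`. -/
theorem ProbabilityTheory.CondIndep.condExp_sup_ae_eq {Ω : Type*} {m' m g b mΩ : MeasurableSpace Ω}
    [StandardBorelSpace Ω] {P : Measure Ω} [IsFiniteMeasure P] {hm' : m' ≤ mΩ} (hg : g ≤ mΩ)
    (hb : b ≤ mΩ) (h : CondIndep m' g b hm' P) (hm'm : m' ≤ m) (hmb : m ≤ b ⊔ m') {W : Ω → ℝ}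
    (hW : Integrable W P) (hWm : AEStronglyMeasurable[b ⊔ m'] W P) :
    P[W | g ⊔ m] =ᵐ[P] P[W | m] := by
  have hn : b ⊔ m' ≤ mΩ := sup_le hb hm'
  have hm : m ≤ mΩ := hmb.trans hn
  refine condExp_sup_ae_eq_of_forall_setIntegral_inter hg hm hW integrable_condExp
    (stronglyMeasurable_condExp.mono (le_sup_right : m ≤ g ⊔ m)).aestronglyMeasurable
    fun s t hs ht => ?_
  have hs_int : Integrable (s.indicator fun _ => (1 : ℝ)) P :=
    (integrable_const 1).indicator (hg s hs)
  have hs_bdd : ∀ᵐ ω ∂P, ‖s.indicator (fun _ => (1 : ℝ)) ω‖ ≤ 1 :=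
    ae_of_all _ fun ω => by by_cases h : ω ∈ s <;> simp [h]
  have hn_eq := h.condExp_indicator_sup_ae_eq hg hb hs
  have hm_eq : P[s.indicator (fun _ => (1 : ℝ)) | m]
      =ᵐ[P] P[s.indicator (fun _ => (1 : ℝ)) | m'] := by
    have h₁ := condExp_condExp_of_le (f := s.indicator fun _ => (1 : ℝ)) (μ := P) hmb hn
    have h₂ := condExp_congr_ae (m := m) hn_eq
    rw [condExp_of_stronglyMeasurable hm (stronglyMeasurable_condExp.mono hm'm)
      integrable_condExp] at h₂
    exact h₁.symm.trans h₂
  rw [← setIntegral_indicator_one_mul (hg s hs), ← setIntegral_indicator_one_mul (hg s hs),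
    ← setIntegral_condExp_mul hm ht hs_int stronglyMeasurable_condExp.aestronglyMeasurable
      (integrable_condExp.bdd_mul hs_int.aestronglyMeasurable hs_bdd),
    ← setIntegral_condExp_mul hn (hmb t ht) hs_int hWm
      (hW.bdd_mul hs_int.aestronglyMeasurable hs_bdd),
    mul_comm, setIntegral_condExp_mul hm ht hW stronglyMeasurable_condExp.aestronglyMeasurable]
  · refine integral_congr_ae (ae_restrict_of_ae ?_)
    filter_upwards [hn_eq, hm_eq] with ω h₁ h₂
    rw [Pi.mul_apply, Pi.mul_apply, h₁, h₂, mul_comm]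
  · exact hW.mul_bdd integrable_condExp.aestronglyMeasurable (ae_norm_condExp_indicator_one_le s)

theorem norm_ind_le_one {Ω : Type*} (A : Ω → ℝ) (a : ℝ) (ω : Ω) : ‖ind A a ω‖ ≤ 1 := by
  unfold ind
  split_ifs <;> simp

theorem Measurable.ind {Ω : Type*} {m : MeasurableSpace Ω} {A : Ω → ℝ} (hA : Measurable A)
    (a : ℝ) : Measurable (ind A a) :=
  Measurable.ite (hA (measurableSet_singleton a)) measurable_const measurable_const

theorem integrable_ind {Ω : Type*} {mΩ : MeasurableSpace Ω} {P : Measure Ω} [IsFiniteMeasure P]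
    {A : Ω → ℝ} (hA : Measurable A) (a : ℝ) : Integrable (ind A a) P :=
  .of_bound (hA.ind a).aestronglyMeasurable 1 (ae_of_all _ (norm_ind_le_one A a))

/-- Conditioning further on `A` a variable that vanishes off the event `A = a` amounts to
normalising by the conditional probability of that event. -/
theorem condExp_sup_comap_ae_eq_ind_mul_div {Ω : Type*} {m mΩ : MeasurableSpace Ω} {P : Measure Ω}
    [IsFiniteMeasure P] (hm : m ≤ mΩ) {A : Ω → ℝ} (hA : Measurable A) (a : ℝ) {V : Ω → ℝ}
    (hV : Integrable V P) (hVA : ∀ ω, A ω ≠ a → V ω = 0) {c : ℝ} (hc : 0 < c)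
    (hpos : ∀ᵐ ω ∂P, c ≤ P[ind A a | m] ω) :
    P[V | m ⊔ MeasurableSpace.comap A inferInstance]
      =ᵐ[P] fun ω => ind A a ω * (P[V | m] ω / P[ind A a | m] ω) := by
  set Q : Ω → ℝ := fun ω => P[V | m] ω / P[ind A a | m] ω
  have hQm : StronglyMeasurable[m] Q :=
    (stronglyMeasurable_condExp.measurable.div
      stronglyMeasurable_condExp.measurable).stronglyMeasurable
  have hQ : Integrable Q P := by
    refine (integrable_condExp (m := m) (f := V)).mul_bdd (c := c⁻¹)
      (g := fun ω => (P[ind A a | m] ω)⁻¹)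
      (stronglyMeasurable_condExp.measurable.inv.mono hm le_rfl).aestronglyMeasurable ?_
    filter_upwards [hpos] with ω hω
    rw [norm_inv, Real.norm_of_nonneg (hc.le.trans hω)]
    exact inv_anti₀ hc hω
  have hindQ : Integrable (ind A a * Q) P :=
    hQ.bdd_mul (hA.ind a).aestronglyMeasurable (ae_of_all _ (norm_ind_le_one A a))
  classical
  refine condExp_sup_ae_eq_of_forall_setIntegral_inter hm hA.comap_le hV hindQ ?_ ?_
  · refine StronglyMeasurable.aestronglyMeasurable ?_
    refine StronglyMeasurable.mul ?_ (hQm.mono le_sup_left)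
    exact (((comap_measurable A).ind a).stronglyMeasurable).mono le_sup_right
  · rintro t _ ht ⟨s, hs, rfl⟩
    have hset : ∀ f : Ω → ℝ, (∀ ω, A ω ≠ a → f ω = 0) →
        ∫ ω in t ∩ A ⁻¹' s, f ω ∂P = if a ∈ s then ∫ ω in t, f ω ∂P else 0 := by
      intro f hf
      rw [← setIntegral_indicator (hA hs)]
      split_ifs with has
      · congr 1
        ext ω
        by_cases h : A ω = a
        · simp [Set.indicator, h, has]
        · simp [Set.indicator, hf ω h]
      · rw [← integral_zero Ω ℝ (μ := P.restrict t)]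
        congr 1
        ext ω
        by_cases h : A ω = a
        · simp [Set.indicator, h, has]
        · simp [Set.indicator, hf ω h]
    rw [hset _ hVA, hset _ fun ω h => by simp [ind, h]]
    congr 1
    refine (setIntegral_condExp_mul hm ht (integrable_ind hA a) hQm.aestronglyMeasurable
      hindQ).symm.trans ?_
    rw [← setIntegral_condExp hm hV ht]
    refine integral_congr_ae (ae_restrict_of_ae ?_)
    filter_upwards [hpos] with ω hω
    exact mul_div_cancel₀ _ (hc.trans_le hω).ne'

theorem genSig_mono {Ω : Type*} {S T : Set (Ω → ℝ)} (h : S ⊆ T) : genSig S ≤ genSig T :=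
  biSup_mono h

theorem genSig_union {Ω : Type*} (S T : Set (Ω → ℝ)) : genSig (S ∪ T) = genSig S ⊔ genSig T :=
  iSup_union

theorem genSig_singleton {Ω : Type*} (f : Ω → ℝ) :
    genSig {f} = MeasurableSpace.comap f inferInstance :=
  iSup_singleton

theorem measurable_genSig {Ω : Type*} {S : Set (Ω → ℝ)} {f : Ω → ℝ} (hf : f ∈ S) :
    Measurable[genSig S] f :=
  (comap_measurable f).mono (le_biSup (fun f : Ω → ℝ => MeasurableSpace.comap f _) hf) le_rfl

theorem measurable_indUpto_div_cumWeight {Ω : Type*} {m mΩ : MeasurableSpace Ω} (P : Measure Ω)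
    {A : ℕ → Ω → ℝ} (a : ℕ → ℝ) {Z : ℕ → Set (Ω → ℝ)} {k : ℕ}
    (hA : ∀ j < k, Measurable[m] (A j)) (hZ : ∀ j < k, genSig (Z j) ≤ m) :
    Measurable[m] fun ω => indUpto A a k ω / cumWeight P A a Z k ω := by
  unfold indUpto cumWeight
  refine Measurable.div (Finset.measurable_prod _ fun j hj => ?_)
    (Finset.measurable_prod _ fun j hj => ?_)
  · exact (hA j (Finset.mem_range.1 hj)).ind _
  · exact stronglyMeasurable_condExp.measurable.mono (hZ j (Finset.mem_range.1 hj)) le_rfl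

theorem indUpto_div_cumWeight_succ {Ω : Type*} [MeasurableSpace Ω] (P : Measure Ω)
    (A : ℕ → Ω → ℝ) (a : ℕ → ℝ) (Z : ℕ → Set (Ω → ℝ)) (k : ℕ) (ω : Ω) :
    indUpto A a (k + 1) ω / cumWeight P A a Z (k + 1) ω =
      ind (A k) (a k) ω * (indUpto A a k ω / cumWeight P A a Z k ω / propen P A a Z k ω) := by
  simp only [indUpto, cumWeight, Finset.prod_range_succ]
  rw [mul_div_mul_comm]
  ring

theorem Positivity.integrable_indUpto_div_cumWeight {Ω : Type*} [MeasurableSpace Ω]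
    {P : Measure Ω} [IsFiniteMeasure P] {A : ℕ → Ω → ℝ} {a : ℕ → ℝ} {Z : ℕ → Set (Ω → ℝ)} {p : ℕ}
    (hpos : Positivity P A a Z p) (hA : ∀ k, Measurable (A k)) {k : ℕ} (hk : k ≤ p + 1) :
    Integrable (fun ω => indUpto A a k ω / cumWeight P A a Z k ω) P := by
  obtain ⟨c, hc, hpos⟩ := hpos
  induction k with
  | zero => simp [indUpto, cumWeight]
  | succ k ih =>
    simp only [indUpto_div_cumWeight_succ]
    refine Integrable.bdd_mul (c := 1) ?_ ((hA k).ind (a k)).aestronglyMeasurable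
      (ae_of_all _ (norm_ind_le_one _ _))
    refine (ih (by omega)).mul_bdd (c := c⁻¹) (g := fun ω => (propen P A a Z k ω)⁻¹)
      integrable_condExp.aestronglyMeasurable.aemeasurable.inv.aestronglyMeasurable ?_
    filter_upwards [hpos k (by omega)] with ω hω
    rw [norm_inv, Real.norm_of_nonneg (hc.le.trans hω)]
    exact inv_anti₀ hc hω

/-- telescoping inverse-weight identity in the proof of Lemma 4.2.  Assume
`(G, B)` satisfies positivity, `G_k ⊥⊥ B_(k-1) ∣ G_(k-1) ∪ {A_(k-1)}` for `k = 1, …, p`, and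
the history propensities `π̃_(a_j) = E[1_(A_j = a_j) ∣ σ(Ḡ_j ∪ Ā_(j-1))]` are bounded below by
some `c > 0` a.s.  Then for every `k = 0, …, p`, conditionally on the `G`-history,
`E[ I_(ā_(k-1)) / λ_(ā_(k-1))((G,B)) ∣ σ(Ḡ_(k-1) ∪ Ā_(k-1)) ] = I_(ā_(k-1)) / λ̃_(ā_(k-1))`
almost surely. -/
theorem condexp_inverse_weight_telescope {Ω : Type*} [mΩ : MeasurableSpace Ω] [StandardBorelSpace Ω]
    (P : Measure Ω) [IsProbabilityMeasure P] (p : ℕ)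
    (A : ℕ → Ω → ℝ) (hA : ∀ k, Measurable (A k))
    (hAfin : ∀ k, (Set.range (A k)).Finite)
    (Y : Ω → ℝ) (hYm : Measurable Y) (hYbd : ∃ C : ℝ, ∀ ω, |Y ω| ≤ C)
    (a : ℕ → ℝ) (ha : ∀ k ≤ p, a k ∈ Set.range (A k))
    (K G B : ℕ → Set (Ω → ℝ)) (hKfin : ∀ k, (K k).Finite)
    (hGle : ∀ k, genSig (G k) ≤ mΩ) (hBle : ∀ k, genSig (B k) ≤ mΩ)
    (hdisj : ∀ k ≤ p, Disjoint (G k) (B k))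
    (hcover : ∀ k ≤ p, G k ∪ B k = A '' Set.Iio k ∪ ⋃ j ∈ Set.Iic k, K j)
    (hGAle : ∀ k, genSig (G k ∪ {A k}) ≤ mΩ)
    (H : ℕ → Set (Ω → ℝ))
    (hH : ∀ j, H j = (⋃ i ∈ Set.Iic j, G i) ∪ A '' Set.Iio j)
    (hGBpos : Positivity P A a (fun k => G k ∪ B k) p)
    (hHpos : Positivity P A a H p)
    (hGBk : ∀ k, 1 ≤ k → k ≤ p →
      CondIndep (genSig (G (k - 1) ∪ {A (k - 1)})) (genSig (G k)) (genSig (B (k - 1)))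
        (hGAle (k - 1)) P) :
    ∀ k ≤ p,
      P[fun ω => indUpto A a k ω / cumWeight P A a (fun i => G i ∪ B i) k ω |
          genSig ((⋃ i ∈ Set.Iio k, G i) ∪ A '' Set.Iio k)]
        =ᵐ[P] fun ω => indUpto A a k ω / cumWeight P A a H k ω := by
  set Z : ℕ → Set (Ω → ℝ) := fun i => G i ∪ B i with hZ
  have hZle : ∀ k, genSig (Z k) ≤ mΩ := fun k => by
    rw [hZ, genSig_union]
    exact sup_le (hGle k) (hBle k)
  have hZmono : ∀ {i j}, i ≤ j → j ≤ p → Z i ⊆ Z j := fun {i j} hij hj => by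
    simp only [hZ]
    rw [hcover i (hij.trans hj), hcover j hj]
    exact Set.union_subset_union (Set.image_mono (Set.Iio_subset_Iio hij))
      (Set.biUnion_subset_biUnion_left (Set.Iic_subset_Iic.2 hij))
  have hAZ : ∀ {i j}, i < j → j ≤ p → A i ∈ Z j := fun {i j} hij hj => by
    simp only [hZ]
    rw [hcover j hj]
    exact Or.inl ⟨i, hij, rfl⟩
  have hHZ : ∀ k ≤ p, H k ⊆ Z k := fun k hk => by
    rw [hH]
    refine Set.union_subset (Set.iUnion₂_subset fun i hi => ?_) ?_
    · exact Set.subset_union_left.trans (hZmono hi hk)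
    · rintro _ ⟨i, hi, rfl⟩
      exact hAZ hi hk
  have hHle : ∀ k ≤ p, genSig (H k) ≤ mΩ := fun k hk => (genSig_mono (hHZ k hk)).trans (hZle k)
  have hIio : ∀ (k : ℕ) (S : ℕ → Set (Ω → ℝ)),
      (⋃ i ∈ Set.Iio (k + 1), S i) = ⋃ i ∈ Set.Iic k, S i := fun k S => by
    congr! 3
    exact Nat.lt_succ_iff
  have hM : ∀ k, (⋃ i ∈ Set.Iio (k + 1), G i) ∪ A '' Set.Iio (k + 1) = H k ∪ {A k} := fun k => by
    rw [hIio, hH, Set.union_assoc]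
    congr 1
    ext f
    simp only [Set.mem_image, Set.mem_Iio, Set.mem_union, Set.mem_singleton_iff]
    constructor
    · rintro ⟨i, hi, rfl⟩
      rcases Nat.lt_succ_iff_lt_or_eq.1 hi with hi | rfl
      · exact Or.inl ⟨i, hi, rfl⟩
      · exact Or.inr rfl
    · rintro (⟨i, hi, rfl⟩ | rfl)
      · exact ⟨i, by omega, rfl⟩
      · exact ⟨k, by omega, rfl⟩
  have hHM : ∀ k, H k = G k ∪ ((⋃ i ∈ Set.Iio k, G i) ∪ A '' Set.Iio k) := fun k => by
    rw [hH, ← Set.union_assoc]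
    congr 1
    ext f
    simp only [Set.mem_iUnion, Set.mem_union, Set.mem_Iic, Set.mem_Iio]
    constructor
    · rintro ⟨i, hi, hf⟩
      rcases hi.lt_or_eq with hi | rfl
      · exact Or.inr ⟨i, hi, hf⟩
      · exact Or.inl hf
    · rintro (hf | ⟨i, hi, hf⟩)
      · exact ⟨k, le_rfl, hf⟩
      · exact ⟨i, hi.le, hf⟩
  have hWint : ∀ k ≤ p, Integrable (fun ω => indUpto A a k ω / cumWeight P A a Z k ω) P :=
    fun k hk => hGBpos.integrable_indUpto_div_cumWeight hA (by omega)
  obtain ⟨c, hc, hZpos⟩ := hGBpos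
  obtain ⟨c', hc', hHpos⟩ := hHpos
  have hdrop : ∀ k ≤ p, P[fun ω => indUpto A a k ω / cumWeight P A a Z k ω | genSig (H k)] =ᵐ[P]
      P[fun ω => indUpto A a k ω / cumWeight P A a Z k ω |
        genSig ((⋃ i ∈ Set.Iio k, G i) ∪ A '' Set.Iio k)] := fun k hk => by
    rcases k with _ | k
    · have hbot : genSig ((⋃ i ∈ Set.Iio 0, G i) ∪ A '' Set.Iio 0) ≤ mΩ :=
        (genSig_mono (by rw [hHM 0]; exact Set.subset_union_right)).trans (hHle 0 hk)
      simp only [indUpto, cumWeight, Finset.range_zero, Finset.prod_empty]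
      rw [condExp_const (hHle 0 hk), condExp_const hbot]
    · have hN : Z k ∪ {A k} = B k ∪ (G k ∪ {A k}) := by
        rw [hZ, ← Set.union_assoc, Set.union_comm (B k)]
      have hNsig : genSig (Z k ∪ {A k}) = genSig (B k) ⊔ genSig (G k ∪ {A k}) := by
        rw [hN, genSig_union]
      rw [hHM (k + 1), genSig_union, hM]
      refine CondIndep.condExp_sup_ae_eq (hGle _) (hBle k) (hGBk (k + 1) (by omega) hk) ?_ ?_
        (hWint _ hk) (Measurable.aestronglyMeasurable ?_)
      · refine genSig_mono (Set.union_subset_union_left _ ?_)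
        rw [hHM]
        exact Set.subset_union_left
      · refine le_of_le_of_eq ?_ hNsig
        exact genSig_mono (Set.union_subset_union_left _ (hHZ k (by omega)))
      · refine Measurable.mono (ma := genSig (Z k ∪ {A k})) ?_ hNsig.le le_rfl
        refine measurable_indUpto_div_cumWeight (m := genSig (Z k ∪ {A k})) P a
          (fun j hj => measurable_genSig ?_) fun j hj =>
            genSig_mono ((hZmono (Nat.lt_succ_iff.1 hj) (by omega)).trans Set.subset_union_left)
        rcases Nat.lt_succ_iff_lt_or_eq.1 hj with hj | rfl
        · exact Or.inl (hAZ hj (by omega))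
        · exact Or.inr rfl
  intro k
  induction k with
  | zero =>
    intro hk
    refine (hdrop 0 hk).symm.trans ?_
    simp [indUpto, cumWeight, condExp_const (hHle 0 hk)]
  | succ k ih =>
    intro hk
    have hkp : k ≤ p := by omega
    have hVint := hWint (k + 1) hk
    rw [hM, genSig_union, genSig_singleton]
    refine (condExp_sup_comap_ae_eq_ind_mul_div (hHle k hkp) (hA k) (a k) hVint
      (fun ω h => by simp [indUpto_div_cumWeight_succ, ind, h]) hc' (hHpos k hkp)).trans ?_
    have hfull : P[fun ω => indUpto A a (k + 1) ω / cumWeight P A a Z (k + 1) ω | genSig (Z k)]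
        =ᵐ[P] fun ω => indUpto A a k ω / cumWeight P A a Z k ω := by
      have hXm : Measurable[genSig (Z k)]
          fun ω => indUpto A a k ω / cumWeight P A a Z k ω / propen P A a Z k ω :=
        Measurable.div (m := genSig (Z k))
          (measurable_indUpto_div_cumWeight (m := genSig (Z k)) P a
            (fun j hj => measurable_genSig (hAZ hj hkp))
            fun j hj => genSig_mono (hZmono hj.le hkp))
          (stronglyMeasurable_condExp (m := genSig (Z k)) (μ := P)).measurable
      simp only [indUpto_div_cumWeight_succ] at hVint ⊢
      refine (condExp_mul_of_stronglyMeasurable_right hXm.stronglyMeasurable hVint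
        (integrable_ind (hA k) (a k))).trans ?_
      filter_upwards [hZpos k hkp] with ω hω
      exact mul_div_cancel₀ _ (hc.trans_le hω).ne'
    have hR := (condExp_condExp_of_le (genSig_mono (hHZ k hkp)) (hZle k)).symm.trans
      ((condExp_congr_ae hfull).trans ((hdrop k hkp).trans (ih hkp)))
    filter_upwards [hR] with ω hω
    rw [hω, indUpto_div_cumWeight_succ]
    rfl
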